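/- Let X be an (M,p̄)-cookie random walk with α > 0 (so X is transient towards +∞ and T_n < ∞ a.s. for every n). Then there exists a function f : ℕ → ℝ₊ with lim_{K→∞} f(K) = 0 such that for every n ∈ ℕ and every K ∈ ℕ: P(n − inf_{i ≥ T_n} X_i > K) ≤ f(K). -/

import Mathlib

open MeasureTheory ProbabilityTheory Filter Set Asymptotics
open scoped ENNReal NNReal Topology

noncomputable section

/-- The strength of the `j`-th cookie: `p j` for `j ≤ M`, and `1/2` afterwards. -/
def cookieP (M : ℕ) (p : ℕ → ℝ) (j : ℕ) : ℝ :=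
  if j ≤ M then p j else 1 / 2

/-- The parameter `α = (∑_{i=1}^M (2 p_i - 1)) - 1`. -/
def cookieAlpha (M : ℕ) (p : ℕ → ℝ) : ℝ :=
  (∑ i ∈ Finset.Icc 1 M, (2 * p i - 1)) - 1

/-- `X` is an `(M, p̄)`-cookie random walk under the probability measure `P`:
`X 0 = 0` a.s., nearest-neighbour steps, and upon the `j`-th visit of the current
site the walk steps to the right with probability `p j` if `j ≤ M` and `1/2` otherwise. -/
structure IsCookieRW (M : ℕ) (p : ℕ → ℝ) {Ω : Type*} [MeasurableSpace Ω]
    (P : Measure Ω) (X : ℕ → Ω → ℤ) : Prop where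
  isProb : IsProbabilityMeasure P
  meas : ∀ n, Measurable (X n)
  init : P {ω | X 0 ω = 0} = 1
  steps : ∀ n, P {ω | |X (n + 1) ω - X n ω| = 1} = 1
  cond : ∀ (n : ℕ) (x : ℕ → ℤ), x 0 = 0 →
    0 < P {ω | ∀ i ≤ n, X i ω = x i} →
    P ({ω | X (n + 1) ω = x n + 1} ∩ {ω | ∀ i ≤ n, X i ω = x i})
      = ENNReal.ofReal
          (cookieP M p (((Finset.range (n + 1)).filter (fun i => x i = x n)).card))
        * P {ω | ∀ i ≤ n, X i ω = x i}

/-- First hitting time of level `n` by the walk `X`. -/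
def hitT {Ω : Type*} (X : ℕ → Ω → ℤ) (n : ℕ) (ω : Ω) : ℕ :=
  sInf {k | X k ω = (n : ℤ)}

section Potential

/-- The departure counts `L` after one more departure from `x`. -/
def bump (L : ℤ → ℕ) (x : ℤ) : ℤ → ℕ := Function.update L x (L x + 1)

/-- One step of the walk on states `(L, x)`, where `L` counts the past departures from each site and
`x` is the current site: it moves to `x + 1` with probability `c (L x)` and to `l x` otherwise. -/
def stepOp (c : ℕ → ℝ) (l : ℤ → ℤ) (φ : (ℤ → ℕ) → ℤ → ℝ) (L : ℤ → ℕ) (x : ℤ) : ℝ :=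
  c (L x) * φ (bump L x) (x + 1) + (1 - c (L x)) * φ (bump L x) (l x)

open Classical in
/-- The probability to stay in `A` during the first `t` steps. -/
def surv (c : ℕ → ℝ) (l : ℤ → ℤ) (A : Set ℤ) : ℕ → (ℤ → ℕ) → ℤ → ℝ
  | 0, _, x => if x ∈ A then 1 else 0
  | t + 1, L, x => if x ∈ A then stepOp c l (surv c l A t) L x else 0

open Classical in
/-- The expected drift consumed at site `j` during the first `t` steps, before exiting `A`. -/
def eaten (c : ℕ → ℝ) (l : ℤ → ℤ) (A : Set ℤ) (j : ℤ) : ℕ → (ℤ → ℕ) → ℤ → ℝ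
  | 0, _, _ => 0
  | t + 1, L, x =>
    if x ∈ A then (if x = j then 2 * c (L x) - 1 else 0) + stepOp c l (eaten c l A j t) L x else 0

/-- The expected drift consumed at site `j` before exiting `A`. -/
def eatenLim (c : ℕ → ℝ) (l : ℤ → ℤ) (A : Set ℤ) (j : ℤ) (L : ℤ → ℕ) (x : ℤ) : ℝ :=
  ⨆ t, eaten c l A j t L x

/-- Left move of the walk reflected at `r`. -/
def reflLeft (r x : ℤ) : ℤ := max (x - 1) r

/-- Left move of the walk without reflection. -/
def freeLeft (x : ℤ) : ℤ := x - 1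

/-- The drift remaining at a site after `k` departures. -/
def driftFrom (c : ℕ → ℝ) (M k : ℕ) : ℝ := ∑ i ∈ Finset.Ico k M, (2 * c i - 1)

lemma bump_self (L : ℤ → ℕ) (x : ℤ) : bump L x x = L x + 1 := by simp [bump]

lemma bump_of_ne (L : ℤ → ℕ) {x y : ℤ} (h : y ≠ x) : bump L x y = L y := by simp [bump, h]

variable {c : ℕ → ℝ} {l : ℤ → ℤ} {A : Set ℤ} {j : ℤ}

lemma stepOp_mono (hc : ∀ k, 1 / 2 ≤ c k ∧ c k < 1) {φ ψ : (ℤ → ℕ) → ℤ → ℝ} {L : ℤ → ℕ} {x : ℤ}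
    (h₁ : φ (bump L x) (x + 1) ≤ ψ (bump L x) (x + 1))
    (h₂ : φ (bump L x) (l x) ≤ ψ (bump L x) (l x)) :
    stepOp c l φ L x ≤ stepOp c l ψ L x := by
  have := hc (L x)
  unfold stepOp
  gcongr <;> linarith

lemma surv_nonneg (hc : ∀ k, 1 / 2 ≤ c k ∧ c k < 1) (t : ℕ) (L : ℤ → ℕ) (x : ℤ) :
    0 ≤ surv c l A t L x := by
  induction t generalizing L x with
  | zero => unfold surv; split_ifs <;> norm_num
  | succ t ih =>
    unfold surv
    split_ifs
    · have := hc (L x)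
      have h₁ := ih (bump L x) (x + 1)
      have h₂ := ih (bump L x) (l x)
      have : 0 ≤ c (L x) := by linarith
      have : 0 ≤ 1 - c (L x) := by linarith
      unfold stepOp
      positivity
    · exact le_rfl

lemma surv_of_notMem {x : ℤ} (h : x ∉ A) (t : ℕ) (L : ℤ → ℕ) : surv c l A t L x = 0 := by
  cases t <;> simp [surv, h]

lemma surv_zero_of_mem {x : ℤ} (h : x ∈ A) (L : ℤ → ℕ) : surv c l A 0 L x = 1 := by
  simp [surv, h]

lemma surv_succ_of_mem {x : ℤ} (h : x ∈ A) (t : ℕ) (L : ℤ → ℕ) :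
    surv c l A (t + 1) L x = stepOp c l (surv c l A t) L x := by
  simp [surv, h]

lemma surv_le_one (hc : ∀ k, 1 / 2 ≤ c k ∧ c k < 1) (t : ℕ) (L : ℤ → ℕ) (x : ℤ) :
    surv c l A t L x ≤ 1 := by
  induction t generalizing L x with
  | zero => unfold surv; split_ifs <;> norm_num
  | succ t ih =>
    unfold surv
    split_ifs
    · refine (stepOp_mono (ψ := fun _ _ => 1) hc (ih _ _) (ih _ _)).trans ?_
      simp [stepOp]
    · norm_num

lemma surv_antitone (hc : ∀ k, 1 / 2 ≤ c k ∧ c k < 1) (L : ℤ → ℕ) (x : ℤ) :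
    Antitone fun t => surv c l A t L x := by
  refine antitone_nat_of_succ_le fun t => ?_
  induction t generalizing L x with
  | zero =>
    by_cases h : x ∈ A
    · rw [surv_zero_of_mem h]; exact surv_le_one hc _ _ _
    · simp [surv_of_notMem h]
  | succ t ih =>
    by_cases h : x ∈ A
    · rw [surv_succ_of_mem h, surv_succ_of_mem h]
      exact stepOp_mono hc (ih _ _) (ih _ _)
    · simp [surv_of_notMem h]

lemma surv_mono_set (hc : ∀ k, 1 / 2 ≤ c k ∧ c k < 1) {B : Set ℤ} (hAB : A ⊆ B) (t : ℕ)
    (L : ℤ → ℕ) (x : ℤ) : surv c l A t L x ≤ surv c l B t L x := by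
  induction t generalizing L x with
  | zero =>
    by_cases h : x ∈ A
    · rw [surv_zero_of_mem h, surv_zero_of_mem (hAB h)]
    · rw [surv_of_notMem h]; exact surv_nonneg hc _ _ _
  | succ t ih =>
    by_cases h : x ∈ A
    · rw [surv_succ_of_mem h, surv_succ_of_mem (hAB h)]
      exact stepOp_mono hc (ih _ _) (ih _ _)
    · rw [surv_of_notMem h]; exact surv_nonneg hc _ _ _

lemma surv_shift (a m : ℤ) (t : ℕ) (L L' : ℤ → ℕ) (x : ℤ) (hL : ∀ y > a, L (y + m) = L' y) :
    surv c freeLeft (Ioi (a + m)) t L (x + m) = surv c freeLeft (Ioi a) t L' x := by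
  induction t generalizing L L' x with
  | zero => simp [surv]
  | succ t ih =>
    by_cases h : x ∈ Ioi a
    · have h' : x + m ∈ Ioi (a + m) := by simpa using h
      have hb : ∀ y > a, bump L (x + m) (y + m) = bump L' x y := by
        intro y hy
        by_cases hyx : y = x
        · subst hyx; rw [bump_self, bump_self, hL y hy]
        · rw [bump_of_ne _ hyx, bump_of_ne _ (by omega), hL y hy]
      rw [surv_succ_of_mem h, surv_succ_of_mem h', stepOp, stepOp, hL x h,
        ← ih _ _ (x + 1) hb, ← ih _ _ (freeLeft x) hb]
      simp only [freeLeft]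
      rw [show x + m + 1 = x + 1 + m by ring, show x + m - 1 = x - 1 + m by ring]
    · rw [surv_of_notMem h, surv_of_notMem (by simpa using h)]

lemma tendsto_surv_step (hc : ∀ k, 1 / 2 ≤ c k ∧ c k < 1) {L : ℤ → ℕ} {x : ℤ} (hx : x ∈ A)
    (h : Tendsto (fun t => surv c l A t L x) atTop (𝓝 0)) :
    Tendsto (fun t => surv c l A t (bump L x) (x + 1)) atTop (𝓝 0) ∧
      Tendsto (fun t => surv c l A t (bump L x) (l x)) atTop (𝓝 0) := by
  have h' := (tendsto_add_atTop_iff_nat 1).2 h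
  simp only [surv_succ_of_mem hx, stepOp] at h'
  have hq := hc (L x)
  have n₁ := fun t => surv_nonneg (l := l) (A := A) hc t (bump L x) (x + 1)
  have n₂ := fun t => surv_nonneg (l := l) (A := A) hc t (bump L x) (l x)
  have p₁ : 0 < c (L x) := by linarith
  have p₂ : 0 < 1 - c (L x) := by linarith
  constructor
  · have := h'.div_const (c (L x))
    rw [zero_div] at this
    refine squeeze_zero n₁ (fun t => ?_) this
    rw [le_div_iff₀ p₁]
    nlinarith [mul_nonneg p₂.le (n₂ t)]
  · have := h'.div_const (1 - c (L x))
    rw [zero_div] at this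
    refine squeeze_zero n₂ (fun t => ?_) this
    rw [le_div_iff₀ p₂]
    nlinarith [mul_nonneg p₁.le (n₁ t)]

lemma mul_surv_reflLeft_le (hc : ∀ k, 1 / 2 ≤ c k ∧ c k < 1) (t : ℕ) (L : ℤ → ℕ) (x : ℤ)
    (h0 : 0 ≤ x) (hj : x ≤ j) :
    t * surv c (reflLeft 0) (Iio j) t L x ≤ 2 * ((j : ℝ) ^ 2 - (x : ℝ) ^ 2) := by
  have hx0 : (0 : ℝ) ≤ x := by exact_mod_cast h0
  have hxj : (x : ℝ) ≤ j := by exact_mod_cast hj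
  induction t generalizing L x with
  | zero => simp only [Nat.cast_zero, zero_mul]; nlinarith
  | succ t ih =>
    by_cases h : x ∈ Iio j
    · have hlt : x < j := h
      have hlt' : (x : ℝ) + 1 ≤ j := by exact_mod_cast hlt
      rw [surv_succ_of_mem h, stepOp]
      have hq := hc (L x)
      have s₁ := surv_le_one (l := reflLeft 0) (A := Iio j) hc t (bump L x) (x + 1)
      have s₂ := surv_le_one (l := reflLeft 0) (A := Iio j) hc t (bump L x) (reflLeft 0 x)
      have i₁ := ih (bump L x) (x + 1) (by omega) (by omega) (by push_cast; linarith)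
        (by push_cast; linarith)
      have hl0 : 0 ≤ reflLeft 0 x := le_max_right _ _
      have hlj : reflLeft 0 x ≤ j := by unfold reflLeft; omega
      have i₂ := ih (bump L x) (reflLeft 0 x) hl0 hlj (by exact_mod_cast hl0)
        (by exact_mod_cast hlj)
      set A₁ := surv c (reflLeft 0) (Iio j) t (bump L x) (x + 1)
      set A₂ := surv c (reflLeft 0) (Iio j) t (bump L x) (reflLeft 0 x)
      have k₁ : ((t : ℝ) + 1) * A₁ ≤ 2 * ((j : ℝ) ^ 2 - (x + 1) ^ 2) + 1 := by
        push_cast at i₁; linarith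
      have k₂ : ((t : ℝ) + 1) * A₂ ≤ 2 * ((j : ℝ) ^ 2 - (reflLeft 0 x : ℝ) ^ 2) + 1 := by
        linarith
      have p₁ : 0 ≤ c (L x) := by linarith
      have p₂ : 0 ≤ 1 - c (L x) := by linarith
      have m₁ := mul_le_mul_of_nonneg_left k₁ p₁
      have m₂ := mul_le_mul_of_nonneg_left k₂ p₂
      push_cast
      rcases h0.eq_or_lt with h00 | h00
      · subst h00
        have : reflLeft 0 0 = 0 := by simp [reflLeft]
        rw [this] at m₂
        push_cast at m₁ m₂ ⊢
        nlinarith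
      · have : reflLeft 0 x = x - 1 := by unfold reflLeft; omega
        have h1 : (1 : ℝ) ≤ x := by exact_mod_cast h00
        rw [this] at m₂
        push_cast at m₁ m₂
        nlinarith
    · rw [surv_of_notMem h]; nlinarith

lemma tendsto_surv_reflLeft (hc : ∀ k, 1 / 2 ≤ c k ∧ c k < 1) (L : ℤ → ℕ) {x : ℤ}
    (h0 : 0 ≤ x) (hj : x ≤ j) :
    Tendsto (fun t => surv c (reflLeft 0) (Iio j) t L x) atTop (𝓝 0) := by
  refine squeeze_zero' (Eventually.of_forall fun t => surv_nonneg hc _ _ _) ?_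
    (tendsto_const_div_atTop_nhds_zero_nat (2 * ((j : ℝ) ^ 2 - (x : ℝ) ^ 2)))
  filter_upwards [eventually_gt_atTop 0] with t ht
  rw [le_div_iff₀ (by exact_mod_cast ht), mul_comm]
  exact mul_surv_reflLeft_le hc t L x h0 hj

lemma mul_surv_freeLeft_le (hc : ∀ k, 1 / 2 ≤ c k ∧ c k < 1) (n a : ℕ) (ha : 0 < a) (t : ℕ)
    (L : ℤ → ℕ) (x : ℤ) (hxn : x ≤ n) :
    t * surv c freeLeft (Iio (n : ℤ)) t L x ≤
      t * ((n - x) / (n + a)) + (((n : ℝ) + a) ^ 2 - (max ((x : ℝ) + a) 0) ^ 2) := by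
  have ha' : (0 : ℝ) < a := by exact_mod_cast ha
  have hn' : (0 : ℝ) ≤ n := by positivity
  have hxn' : (x : ℝ) ≤ n := by exact_mod_cast hxn
  have hsq : 0 ≤ ((n : ℝ) + a) ^ 2 - (max ((x : ℝ) + a) 0) ^ 2 := by
    have h1 : max ((x : ℝ) + a) 0 ≤ n + a := max_le (by linarith) (by linarith)
    have h2 : 0 ≤ max ((x : ℝ) + a) 0 := le_max_right _ _
    nlinarith
  have hna : (0 : ℝ) < n + a := by linarith
  have hdiv : 0 ≤ ((n : ℝ) - x) / (n + a) := div_nonneg (by linarith) hna.le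
  rcases le_or_gt x (-a) with hxa | hxa
  · have h1 : (x : ℝ) ≤ -a := by exact_mod_cast hxa
    have h2 : 1 ≤ ((n : ℝ) - x) / (n + a) := by rw [le_div_iff₀ hna]; linarith
    have h3 := (surv_le_one (l := freeLeft) (A := Iio (n : ℤ)) hc t L x).trans h2
    have := mul_le_mul_of_nonneg_left h3 (Nat.cast_nonneg (α := ℝ) t)
    linarith
  induction t generalizing L x with
  | zero => simpa using hsq
  | succ t ih =>
    by_cases h : x ∈ Iio (n : ℤ)
    · have hlt : x < n := h
      have hlt' : (x : ℝ) + 1 ≤ n := by exact_mod_cast hlt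
      have hxa1 : -(a : ℝ) + 1 ≤ x := by exact_mod_cast hxa
      rw [surv_succ_of_mem h, stepOp]
      have hq := hc (L x)
      have s₁ := surv_le_one (l := freeLeft) (A := Iio (n : ℤ)) hc t (bump L x) (x + 1)
      have s₂ := surv_le_one (l := freeLeft) (A := Iio (n : ℤ)) hc t (bump L x) (freeLeft x)
      have key : ∀ y : ℤ, y ≤ n → -(a : ℤ) ≤ y → ∀ L : ℤ → ℕ,
          t * surv c freeLeft (Iio (n : ℤ)) t L y ≤
            t * ((n - y) / (n + a)) + (((n : ℝ) + a) ^ 2 - ((y : ℝ) + a) ^ 2) := by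
        intro y hy hya L
        have hy' : (y : ℝ) ≤ n := by exact_mod_cast hy
        have hya' : -(a : ℝ) ≤ y := by exact_mod_cast hya
        have hm : max ((y : ℝ) + a) 0 = y + a := max_eq_left (by linarith)
        rcases hya.eq_or_lt with hya | hya
        · have h1 : (y : ℝ) = -a := by exact_mod_cast hya.symm
          have h2 : ((n : ℝ) - y) / (n + a) = 1 := by rw [h1]; field_simp; ring
          have h3 := surv_le_one (l := freeLeft) (A := Iio (n : ℤ)) hc t L y
          have := mul_le_mul_of_nonneg_left h3 (Nat.cast_nonneg (α := ℝ) t)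
          rw [h2]
          nlinarith
        · rw [← hm]
          refine ih L y hy hy' ?_ ?_ hya
          · rw [hm]; nlinarith
          · exact div_nonneg (by linarith) hna.le
      have i₁ := key (x + 1) (by omega) (by omega) (bump L x)
      have i₂ := key (x - 1) (by omega) (by omega) (bump L x)
      have hm : max ((x : ℝ) + a) 0 = x + a := max_eq_left (by linarith)
      rw [hm]
      rw [freeLeft] at s₂ ⊢
      set A₁ := surv c freeLeft (Iio (n : ℤ)) t (bump L x) (x + 1)
      set A₂ := surv c freeLeft (Iio (n : ℤ)) t (bump L x) (x - 1)
      have p₁ : 0 ≤ c (L x) := by linarith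
      have p₂ : 0 ≤ 1 - c (L x) := by linarith
      have m₁ := mul_le_mul_of_nonneg_left (add_le_add i₁ s₁) p₁
      have m₂ := mul_le_mul_of_nonneg_left (add_le_add i₂ s₂) p₂
      push_cast at m₁ m₂ ⊢
      have hD : c (L x) * (t * ((n - (x + 1 : ℝ)) / (n + a))) +
          (1 - c (L x)) * (t * ((n - (x - 1 : ℝ)) / (n + a))) ≤ t * ((n - x) / (n + a)) := by
        have : t * (((n : ℝ) - x) / (n + a)) - (c (L x) * (t * ((n - (x + 1 : ℝ)) / (n + a))) +
          (1 - c (L x)) * (t * ((n - (x - 1 : ℝ)) / (n + a)))) =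
            t * ((2 * c (L x) - 1) / (n + a)) := by field_simp; ring
        have : 0 ≤ t * ((2 * c (L x) - 1) / ((n : ℝ) + a)) :=
          mul_nonneg (by positivity) (div_nonneg (by linarith) hna.le)
        linarith
      have hdr : 0 ≤ (x + a : ℝ) * (2 * c (L x) - 1) := mul_nonneg (by linarith) (by linarith)
      nlinarith
    · rw [surv_of_notMem h, mul_zero]
      positivity

lemma tendsto_surv_freeLeft (hc : ∀ k, 1 / 2 ≤ c k ∧ c k < 1) (n : ℕ) (L : ℤ → ℕ) :
    Tendsto (fun t => surv c freeLeft (Iio (n : ℤ)) t L 0) atTop (𝓝 0) := by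
  rw [Metric.tendsto_atTop]
  intro η hη
  obtain ⟨a, ha⟩ := exists_nat_gt (max (2 * n / η) 0)
  have ha0 : (0 : ℝ) < a := (le_max_right _ _).trans_lt ha
  have ha1 : 2 * n / η < a := (le_max_left _ _).trans_lt ha
  obtain ⟨t₀, ht₀⟩ := exists_nat_gt (2 * ((n : ℝ) + a) ^ 2 / η)
  refine ⟨t₀ + 1, fun t ht => ?_⟩
  have ht' : (t₀ : ℝ) + 1 ≤ t := by exact_mod_cast ht
  have h := mul_surv_freeLeft_le (c := c) hc n a (by exact_mod_cast ha0) t L 0 (by positivity)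
  have h0 := surv_nonneg (l := freeLeft) (A := Iio (n : ℤ)) hc t L 0
  rw [Real.dist_eq, sub_zero, abs_of_nonneg h0]
  rw [div_lt_iff₀ hη] at ha1 ht₀
  have htp : (0 : ℝ) < t := by linarith [Nat.cast_nonneg (α := ℝ) t₀]
  have hn0 : (0 : ℝ) ≤ n := by positivity
  have hfrac : ((n : ℝ) - (0 : ℤ)) / (n + a) < η / 2 := by
    rw [div_lt_iff₀ (by linarith)]; push_cast; nlinarith
  have hmax : 0 ≤ (max (((0 : ℤ) : ℝ) + a) 0) ^ 2 := by positivity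
  by_contra! hcon
  have := mul_le_mul_of_nonneg_left hcon htp.le
  nlinarith [mul_lt_mul_of_pos_left hfrac htp]

lemma eaten_succ_of_mem {x : ℤ} (h : x ∈ A) (t : ℕ) (L : ℤ → ℕ) :
    eaten c l A j (t + 1) L x =
      (if x = j then 2 * c (L x) - 1 else 0) + stepOp c l (eaten c l A j t) L x := by
  simp [eaten, h]

lemma eaten_of_notMem {x : ℤ} (h : x ∉ A) (t : ℕ) (L : ℤ → ℕ) : eaten c l A j t L x = 0 := by
  cases t <;> simp [eaten, h]

lemma stepOp_nonneg (hc : ∀ k, 1 / 2 ≤ c k ∧ c k < 1) {φ : (ℤ → ℕ) → ℤ → ℝ}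
    (hφ : ∀ L x, 0 ≤ φ L x) (L : ℤ → ℕ) (x : ℤ) : 0 ≤ stepOp c l φ L x := by
  have := hc (L x)
  have h₁ : 0 ≤ c (L x) := by linarith
  have h₂ : 0 ≤ 1 - c (L x) := by linarith
  exact add_nonneg (mul_nonneg h₁ (hφ _ _)) (mul_nonneg h₂ (hφ _ _))

lemma drift_nonneg (hc : ∀ k, 1 / 2 ≤ c k ∧ c k < 1) (k : ℕ) : 0 ≤ 2 * c k - 1 := by
  linarith [hc k]

lemma eaten_nonneg (hc : ∀ k, 1 / 2 ≤ c k ∧ c k < 1) (t : ℕ) (L : ℤ → ℕ) (x : ℤ) :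
    0 ≤ eaten c l A j t L x := by
  induction t generalizing L x with
  | zero => exact le_rfl
  | succ t ih =>
    by_cases h : x ∈ A
    · rw [eaten_succ_of_mem h]
      refine add_nonneg ?_ (stepOp_nonneg hc ih L x)
      split_ifs
      exacts [drift_nonneg hc _, le_rfl]
    · rw [eaten_of_notMem h]

lemma eaten_monotone (hc : ∀ k, 1 / 2 ≤ c k ∧ c k < 1) (L : ℤ → ℕ) (x : ℤ) :
    Monotone fun t => eaten c l A j t L x := by
  refine monotone_nat_of_le_succ fun t => ?_
  induction t generalizing L x with
  | zero => exact eaten_nonneg hc _ _ _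
  | succ t ih =>
    by_cases h : x ∈ A
    · rw [eaten_succ_of_mem h, eaten_succ_of_mem h]
      gcongr
      exact stepOp_mono hc (ih _ _) (ih _ _)
    · simp [eaten_of_notMem h]

lemma driftFrom_nonneg (hc : ∀ k, 1 / 2 ≤ c k ∧ c k < 1) (M k : ℕ) : 0 ≤ driftFrom c M k :=
  Finset.sum_nonneg fun i _ => drift_nonneg hc i

lemma driftFrom_eq {M : ℕ} (hM : ∀ k, M ≤ k → c k = 1 / 2) (k : ℕ) :
    driftFrom c M k = 2 * c k - 1 + driftFrom c M (k + 1) := by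
  unfold driftFrom
  rcases lt_or_ge k M with h | h
  · rw [Finset.sum_eq_sum_Ico_succ_bot h]
  · rw [Finset.Ico_eq_empty_of_le h, Finset.Ico_eq_empty_of_le (h.trans (Nat.le_succ k)), hM k h]
    norm_num

lemma eaten_le_driftFrom (hc : ∀ k, 1 / 2 ≤ c k ∧ c k < 1) {M : ℕ}
    (hM : ∀ k, M ≤ k → c k = 1 / 2) (t : ℕ) (L : ℤ → ℕ) (x : ℤ) :
    eaten c l A j t L x ≤ driftFrom c M (L j) := by
  induction t generalizing L x with
  | zero => exact driftFrom_nonneg hc _ _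
  | succ t ih =>
    by_cases h : x ∈ A
    · rw [eaten_succ_of_mem h]
      have hs := stepOp_mono (l := l) (ψ := fun L _ => driftFrom c M (L j)) hc
        (ih (bump L x) (x + 1)) (ih (bump L x) (l x))
      have he : stepOp c l (fun L _ => driftFrom c M (L j)) L x = driftFrom c M (bump L x j) := by
        unfold stepOp; ring
      rw [he] at hs
      split_ifs with hxj
      · subst hxj
        rw [bump_self] at hs
        rw [driftFrom_eq hM]
        linarith
      · rw [bump_of_ne _ (Ne.symm hxj)] at hs
        linarith
    · rw [eaten_of_notMem h]; exact driftFrom_nonneg hc _ _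

lemma tendsto_eaten (hc : ∀ k, 1 / 2 ≤ c k ∧ c k < 1) {M : ℕ}
    (hM : ∀ k, M ≤ k → c k = 1 / 2) (L : ℤ → ℕ) (x : ℤ) :
    Tendsto (fun t => eaten c l A j t L x) atTop (𝓝 (eatenLim c l A j L x)) :=
  tendsto_atTop_ciSup (eaten_monotone hc L x)
    ⟨_, by rintro _ ⟨t, rfl⟩; exact eaten_le_driftFrom hc hM t L x⟩

lemma eaten_le_eatenLim (hc : ∀ k, 1 / 2 ≤ c k ∧ c k < 1) {M : ℕ}
    (hM : ∀ k, M ≤ k → c k = 1 / 2) (t : ℕ) (L : ℤ → ℕ) (x : ℤ) :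
    eaten c l A j t L x ≤ eatenLim c l A j L x :=
  (eaten_monotone hc L x).ge_of_tendsto (tendsto_eaten hc hM L x) t

lemma eatenLim_nonneg (hc : ∀ k, 1 / 2 ≤ c k ∧ c k < 1) {M : ℕ}
    (hM : ∀ k, M ≤ k → c k = 1 / 2) (L : ℤ → ℕ) (x : ℤ) : 0 ≤ eatenLim c l A j L x :=
  eaten_le_eatenLim hc hM 0 L x

lemma eatenLim_eq (hc : ∀ k, 1 / 2 ≤ c k ∧ c k < 1) {M : ℕ}
    (hM : ∀ k, M ≤ k → c k = 1 / 2) (L : ℤ → ℕ) {x : ℤ} (h : x ∈ A) :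
    eatenLim c l A j L x =
      (if x = j then 2 * c (L x) - 1 else 0) + stepOp c l (eatenLim c l A j) L x := by
  have h₁ := (tendsto_add_atTop_iff_nat 1).2 (tendsto_eaten (l := l) (A := A) (j := j) hc hM L x)
  simp only [eaten_succ_of_mem h] at h₁
  refine tendsto_nhds_unique h₁ (tendsto_const_nhds.add ?_)
  exact ((tendsto_eaten hc hM _ _).const_mul _).add ((tendsto_eaten hc hM _ _).const_mul _)

lemma sum_eaten_le (hc : ∀ k, 1 / 2 ≤ c k ∧ c k < 1) (N t : ℕ) (L : ℤ → ℕ) (x : ℤ)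
    (h0 : 0 ≤ x) (hN : x ≤ N) :
    ∑ j ∈ Finset.range N, eaten c (reflLeft 0) (Iio (N : ℤ)) j t L x ≤ N - x := by
  have hN' : (x : ℝ) ≤ N := by exact_mod_cast hN
  induction t generalizing L x with
  | zero => simpa [eaten] using hN'
  | succ t ih =>
    by_cases h : x ∈ Iio (N : ℤ)
    · have hlt : x < N := h
      have hlt' : (x : ℝ) + 1 ≤ N := by exact_mod_cast hlt
      simp only [eaten_succ_of_mem h, stepOp]
      rw [Finset.sum_add_distrib, Finset.sum_add_distrib, ← Finset.mul_sum, ← Finset.mul_sum]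
      have hd : ∑ j ∈ Finset.range N, (if x = (j : ℤ) then 2 * c (L x) - 1 else 0) =
          2 * c (L x) - 1 := by
        obtain ⟨k, rfl⟩ := Int.eq_ofNat_of_zero_le h0
        have hk : k < N := by exact_mod_cast hlt
        simp [hk]
      rw [hd]
      have hq := hc (L x)
      have hl0 : 0 ≤ reflLeft 0 x := le_max_right _ _
      have hl1 : x - 1 ≤ reflLeft 0 x := le_max_left _ _
      have hlN : reflLeft 0 x ≤ N := by unfold reflLeft; omega
      have hl1' : (x : ℝ) - 1 ≤ reflLeft 0 x := by exact_mod_cast hl1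
      have i₁ := ih (bump L x) (x + 1) (by omega) (by omega) (by push_cast; linarith)
      have i₂ := ih (bump L x) (reflLeft 0 x) hl0 hlN (by exact_mod_cast hlN)
      have m₁ := mul_le_mul_of_nonneg_left i₁ (show 0 ≤ c (L x) by linarith)
      have m₂ := mul_le_mul_of_nonneg_left (i₂.trans (sub_le_sub_left hl1' _))
        (show 0 ≤ 1 - c (L x) by linarith)
      push_cast at m₁ m₂
      nlinarith
    · simp only [eaten_of_notMem h, Finset.sum_const_zero]; linarith

lemma le_eatenLim_of_reach (hc : ∀ k, 1 / 2 ≤ c k ∧ c k < 1) {M : ℕ}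
    (hM : ∀ k, M ≤ k → c k = 1 / 2) {N : ℤ} (hjN : j < N) {v : ℝ} {L : ℤ → ℕ}
    (hv : ∀ L' : ℤ → ℕ, (∀ y ≥ j, L' y = L y) → v ≤ eatenLim c (reflLeft 0) (Iio N) j L' j)
    {x : ℤ} (h0 : 0 ≤ x) (hx : x ≤ j) : v ≤ eatenLim c (reflLeft 0) (Iio N) j L x := by
  have key : ∀ (t : ℕ) (L' : ℤ → ℕ) (x : ℤ), (∀ y ≥ j, L' y = L y) → 0 ≤ x → x ≤ j →
      (1 - surv c (reflLeft 0) (Iio j) t L' x) * v ≤ eatenLim c (reflLeft 0) (Iio N) j L' x := by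
    intro t
    induction t with
    | zero =>
      intro L' x hL' h0 hx
      rcases hx.eq_or_lt with rfl | hx
      · rw [surv_of_notMem (by simp)]; simpa using hv L' hL'
      · rw [surv_zero_of_mem (mem_Iio.2 hx)]; simpa using eatenLim_nonneg hc hM L' x
    | succ t ih =>
      intro L' x hL' h0 hx
      rcases hx.eq_or_lt with rfl | hx
      · rw [surv_of_notMem (by simp)]; simpa using hv L' hL'
      · have hb : ∀ y ≥ j, bump L' x y = L y := fun y hy => by
          rw [bump_of_ne _ (by omega), hL' y hy]
        have hl0 : 0 ≤ reflLeft 0 x := le_max_right _ _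
        have hlj : reflLeft 0 x ≤ j := by unfold reflLeft; omega
        have hs := stepOp_mono (l := reflLeft 0)
          (φ := fun L x => (1 - surv c (reflLeft 0) (Iio j) t L x) * v) hc
          (ih (bump L' x) (x + 1) hb (by omega) (by omega))
          (ih (bump L' x) (reflLeft 0 x) hb hl0 hlj)
        rw [eatenLim_eq hc hM _ (show x ∈ Iio N from hx.trans hjN), if_neg hx.ne,
          surv_succ_of_mem (mem_Iio.2 hx), zero_add]
        refine le_trans (le_of_eq ?_) hs
        unfold stepOp
        ring
  have hlim := ((tendsto_surv_reflLeft hc L h0 hx).const_sub 1).mul_const v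
  rw [sub_zero, one_mul] at hlim
  exact le_of_tendsto' hlim fun t => key t L x (fun _ _ => rfl) h0 hx

lemma eaten_shift (j : ℤ) (t : ℕ) (L L' : ℤ → ℕ) (x : ℤ) (h0 : 0 ≤ x)
    (hL : ∀ y ≥ 0, L (y + j) = L' y) :
    eaten c (reflLeft j) univ j t L (x + j) = eaten c (reflLeft 0) univ 0 t L' x := by
  induction t generalizing L L' x with
  | zero => rfl
  | succ t ih =>
    have hb : ∀ y ≥ 0, bump L (x + j) (y + j) = bump L' x y := by
      intro y hy
      by_cases hyx : y = x
      · subst hyx; rw [bump_self, bump_self, hL y hy]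
      · rw [bump_of_ne _ hyx, bump_of_ne _ (by omega), hL y hy]
    rw [eaten_succ_of_mem (mem_univ _), eaten_succ_of_mem (mem_univ _), stepOp, stepOp, hL x h0,
      ← ih _ _ (x + 1) (by omega) hb, ← ih _ _ (reflLeft 0 x) (le_max_right _ _) hb,
      show x + j + 1 = x + 1 + j by ring,
      show reflLeft j (x + j) = reflLeft 0 x + j by unfold reflLeft; omega]
    simp

lemma eaten_le_eatenLim_refl (hc : ∀ k, 1 / 2 ≤ c k ∧ c k < 1) {M : ℕ}
    (hM : ∀ k, M ≤ k → c k = 1 / 2) {N : ℤ} (hj : 0 ≤ j) (t : ℕ) (L : ℤ → ℕ) (x : ℤ)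
    (hx : j ≤ x) (hN : x + t ≤ N) :
    eaten c (reflLeft j) univ j t L x ≤ eatenLim c (reflLeft 0) (Iio N) j L x := by
  induction t generalizing L x with
  | zero => exact eatenLim_nonneg hc hM L x
  | succ t ih =>
    push_cast at hN
    rw [eaten_succ_of_mem (mem_univ _), eatenLim_eq hc hM _ (show x ∈ Iio N by simp; omega)]
    gcongr
    have hq := hc (L x)
    have h₁ := ih (bump L x) (x + 1) (by omega) (by omega)
    have h₂ : eaten c (reflLeft j) univ j t (bump L x) (reflLeft j x) ≤
        eatenLim c (reflLeft 0) (Iio N) j (bump L x) (reflLeft 0 x) := by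
      rcases hx.eq_or_lt with rfl | hx
      · have hr : reflLeft j j = j := by unfold reflLeft; omega
        rw [hr]
        refine le_eatenLim_of_reach hc hM (by omega) (fun L' hL' => ?_) (le_max_right _ _)
          (by unfold reflLeft; omega)
        have e₁ := eaten_shift (c := c) j t (bump L j) (fun y => bump L j (y + j)) 0 le_rfl
          (fun _ _ => rfl)
        have e₂ := eaten_shift (c := c) j t L' (fun y => bump L j (y + j)) 0 le_rfl
          (fun y hy => hL' _ (by omega))
        rw [zero_add] at e₁ e₂
        rw [e₁, ← e₂]
        exact ih L' j le_rfl (by omega)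
      · have e₁ : reflLeft j x = x - 1 := by unfold reflLeft; omega
        have e₂ : reflLeft 0 x = x - 1 := by unfold reflLeft; omega
        rw [e₁, e₂]
        exact ih (bump L x) (x - 1) (by omega) (by omega)
    unfold stepOp
    gcongr <;> linarith

lemma eaten_fresh_le_one (hc : ∀ k, 1 / 2 ≤ c k ∧ c k < 1) {M : ℕ}
    (hM : ∀ k, M ≤ k → c k = 1 / 2) (t : ℕ) :
    eaten c (reflLeft 0) univ 0 t (fun _ => 0) 0 ≤ 1 := by
  set u := eaten c (reflLeft 0) univ 0 t (fun _ => 0) 0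
  have key : ∀ n : ℕ, n * u ≤ t + n := by
    intro n
    have hsum : ∑ j ∈ Finset.range (t + n),
        eatenLim c (reflLeft 0) (Iio ((t + n : ℕ) : ℤ)) j (fun _ => 0) 0 ≤ ((t + n : ℕ) : ℝ) := by
      refine le_of_tendsto' (tendsto_finsetSum _ fun j _ => tendsto_eaten hc hM _ _) fun s => ?_
      simpa using sum_eaten_le hc (t + n) s (fun _ => 0) 0 le_rfl (by positivity)
    have hle : ∑ j ∈ Finset.range n, u ≤ ∑ j ∈ Finset.range (t + n),
        eatenLim c (reflLeft 0) (Iio ((t + n : ℕ) : ℤ)) j (fun _ => 0) 0 := by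
      refine (Finset.sum_le_sum fun j hj => ?_).trans (Finset.sum_le_sum_of_subset_of_nonneg
        (Finset.range_subset_range.2 (Nat.le_add_left n t))
        fun j _ _ => eatenLim_nonneg hc hM _ _)
      have hjn := Finset.mem_range.1 hj
      refine le_eatenLim_of_reach hc hM (by push_cast; omega) (fun L' hL' => ?_) le_rfl
        (by positivity)
      have e := eaten_shift (c := c) j t L' (fun _ => 0) 0 le_rfl
        (fun y hy => hL' _ (by omega))
      rw [zero_add] at e
      change eaten c (reflLeft 0) univ 0 t (fun _ => 0) 0 ≤ _
      rw [← e]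
      exact eaten_le_eatenLim_refl hc hM (by positivity) t L' j le_rfl (by push_cast; omega)
    simp only [Finset.sum_const, Finset.card_range, nsmul_eq_mul] at hle
    push_cast at hsum hle
    linarith
  by_contra! hu
  obtain ⟨n, hn⟩ := exists_nat_gt ((t : ℝ) / (u - 1))
  rw [div_lt_iff₀ (by linarith)] at hn
  linarith [key n]

lemma driftFrom_le_eatenLim (hc : ∀ k, 1 / 2 ≤ c k ∧ c k < 1) {M : ℕ}
    (hM : ∀ k, M ≤ k → c k = 1 / 2) {L L' : ℤ → ℕ} {x : ℤ} (hx : 0 ≤ x)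
    (hL : ∀ y ≥ 0, L' y = L y)
    (h : Tendsto (fun t => surv c freeLeft (Ioi (-2)) t L' x) atTop (𝓝 0)) :
    driftFrom c M (L 0) ≤ eatenLim c (reflLeft 0) univ 0 L x := by
  obtain ⟨n, hn⟩ : ∃ n, M ≤ L 0 + n := ⟨M, Nat.le_add_left _ _⟩
  induction n generalizing L L' x with
  | zero =>
    rw [driftFrom, Finset.Ico_eq_empty_of_le (by simpa using hn), Finset.sum_empty]
    exact eatenLim_nonneg hc hM L x
  | succ n ih =>
    have hbump : ∀ {L L' : ℤ → ℕ}, (∀ y ≥ 0, L' y = L y) → ∀ x : ℤ, ∀ y ≥ 0,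
        bump L' x y = bump L x y := by
      intro L L' hL x y hy
      by_cases hyx : y = x
      · subst hyx; rw [bump_self, bump_self, hL y hy]
      · rw [bump_of_ne _ hyx, bump_of_ne _ hyx, hL y hy]
    have zero_case : ∀ {L₁ L₁' : ℤ → ℕ}, L₁ 0 = L 0 → (∀ y ≥ 0, L₁' y = L₁ y) →
        Tendsto (fun t => surv c freeLeft (Ioi (-2)) t L₁' 0) atTop (𝓝 0) →
        driftFrom c M (L 0) ≤ eatenLim c (reflLeft 0) univ 0 L₁ 0 := by
      intro L₁ L₁' h0 hL₁ h₁
      rw [eatenLim_eq hc hM _ (mem_univ _), if_pos rfl, driftFrom_eq hM, h0]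
      gcongr
      have hb : bump L₁ 0 0 = L 0 + 1 := by rw [bump_self, h0]
      obtain ⟨hr, hl⟩ := tendsto_surv_step hc (show (0 : ℤ) ∈ Ioi (-2) by simp) h₁
      obtain ⟨hlr, -⟩ := tendsto_surv_step hc (show freeLeft 0 ∈ Ioi (-2) by simp [freeLeft]) hl
      have i₁ := ih (by norm_num) (hbump hL₁ 0) hr (by omega)
      have i₂ := ih le_rfl (L := bump L₁ 0) (L' := bump (bump L₁' 0) (freeLeft 0))
        (fun y hy => by
          rw [bump_of_ne _ (by unfold freeLeft; omega)]; exact hbump hL₁ 0 y hy)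
        hlr (by omega)
      rw [hb] at i₁ i₂
      have hq := hc (L₁ 0)
      have hr0 : reflLeft 0 0 = 0 := by simp [reflLeft]
      rw [stepOp, hr0]
      have m₁ := mul_le_mul_of_nonneg_left i₁ (show 0 ≤ c (L₁ 0) by linarith)
      have m₂ := mul_le_mul_of_nonneg_left i₂ (show 0 ≤ 1 - c (L₁ 0) by linarith)
      linarith
    have key : ∀ (t : ℕ) (L₁ L₁' : ℤ → ℕ) (x : ℤ), 0 ≤ x → L₁ 0 = L 0 →
        (∀ y ≥ 0, L₁' y = L₁ y) →
        Tendsto (fun t => surv c freeLeft (Ioi (-2)) t L₁' x) atTop (𝓝 0) →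
        (1 - surv c freeLeft (Ioi 0) t L₁' x) * driftFrom c M (L 0) ≤
          eatenLim c (reflLeft 0) univ 0 L₁ x := by
      intro t
      induction t with
      | zero =>
        intro L₁ L₁' x hx h0 hL₁ h₁
        rcases hx.eq_or_lt with rfl | hx
        · rw [surv_of_notMem (by simp)]; simpa using zero_case h0 hL₁ h₁
        · rw [surv_zero_of_mem (mem_Ioi.2 hx)]; simpa using eatenLim_nonneg hc hM L₁ x
      | succ t iht =>
        intro L₁ L₁' x hx h0 hL₁ h₁
        rcases hx.eq_or_lt with rfl | hx
        · rw [surv_of_notMem (by simp)]; simpa using zero_case h0 hL₁ h₁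
        · obtain ⟨hr, hl⟩ := tendsto_surv_step hc (show x ∈ Ioi (-2) by simp; omega) h₁
          have hl0 : reflLeft 0 x = freeLeft x := by unfold reflLeft freeLeft; omega
          have h0' : bump L₁ x 0 = L 0 := by rw [bump_of_ne _ hx.ne, h0]
          have i₁ := iht _ _ (x + 1) (by omega) h0' (hbump hL₁ x) hr
          have i₂ := iht _ _ (freeLeft x) (by unfold freeLeft; omega) h0' (hbump hL₁ x) hl
          rw [eatenLim_eq hc hM _ (mem_univ _), if_neg hx.ne', zero_add, surv_succ_of_mem (mem_Ioi.2 hx),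
            stepOp, stepOp, hl0, hL₁ x hx.le]
          have hq := hc (L₁ x)
          have m₁ := mul_le_mul_of_nonneg_left i₁ (show 0 ≤ c (L₁ x) by linarith)
          have m₂ := mul_le_mul_of_nonneg_left i₂ (show 0 ≤ 1 - c (L₁ x) by linarith)
          linarith
    have hs : Tendsto (fun t => surv c freeLeft (Ioi 0) t L' x) atTop (𝓝 0) :=
      squeeze_zero (fun t => surv_nonneg hc t L' x)
        (fun t => surv_mono_set hc (Ioi_subset_Ioi (by norm_num)) t L' x) h
    have hlim := (hs.const_sub 1).mul_const (driftFrom c M (L 0))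
    rw [sub_zero, one_mul] at hlim
    exact le_of_tendsto' hlim fun t => key t L L' x hx rfl hL h

/-- The walk started in a fresh environment never goes below its starting point with positive
probability. -/
lemma exists_surv_limit_pos (hc : ∀ k, 1 / 2 ≤ c k ∧ c k < 1) {M : ℕ}
    (hM : ∀ k, M ≤ k → c k = 1 / 2) (hδ : 1 < driftFrom c M 0) :
    ∃ ε : ℝ, 0 < ε ∧
      Tendsto (fun t => surv c freeLeft (Ioi (-1)) t (fun _ => 0) 0) atTop (𝓝 ε) ∧
      ∀ t, ε ≤ surv c freeLeft (Ioi (-1)) t (fun _ => 0) 0 := by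
  have hanti := surv_antitone (l := freeLeft) (A := Ioi (-1)) hc (fun _ => 0) 0
  have hlim := tendsto_atTop_ciInf hanti
    ⟨0, by rintro _ ⟨t, rfl⟩; exact surv_nonneg hc t _ _⟩
  set ε := ⨅ t, surv c freeLeft (Ioi (-1)) t (fun _ => 0) 0
  have hle := hanti.le_of_tendsto hlim
  refine ⟨ε, ?_, hlim, hle⟩
  refine (ge_of_tendsto' hlim fun t => surv_nonneg hc t _ _).lt_of_ne fun h0 => ?_
  rw [← h0] at hlim
  obtain ⟨hr, -⟩ := tendsto_surv_step hc (show (0 : ℤ) ∈ Ioi (-1) by simp) hlim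
  have hsh : ∀ t, surv c freeLeft (Ioi (-1)) t (bump (fun _ => 0) 0) (0 + 1) =
      surv c freeLeft (Ioi (-2)) t (fun y => bump (fun _ => 0) 0 (y + 1)) 0 := fun t =>
    surv_shift (-2) 1 t _ _ 0 fun _ _ => rfl
  simp only [hsh] at hr
  have h₁ := driftFrom_le_eatenLim (L := fun _ => 0) hc hM le_rfl
    (fun y hy => by rw [bump_of_ne _ (by omega)]) hr
  have h₂ : eatenLim c (reflLeft 0) univ 0 (fun _ => 0) 0 ≤ 1 :=
    ciSup_le fun t => eaten_fresh_le_one hc hM t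
  linarith

end Potential

section Walk

/-- The number of departures from `y` before time `k` along the path `x`. -/
def departures (x : ℕ → ℤ) (k : ℕ) (y : ℤ) : ℕ := ((Finset.range k).filter fun i => x i = y).card

variable {Ω : Type*}

/-- The paths that follow `x` up to time `k`. -/
def followsPath (X : ℕ → Ω → ℤ) (x : ℕ → ℤ) (k : ℕ) : Set Ω := {ω | ∀ i ≤ k, X i ω = x i}

/-- The event `F` is determined by the path up to time `k`. -/
def DeterminedBy (X : ℕ → Ω → ℤ) (k : ℕ) (F : Set Ω) : Prop :=
  ∀ ω ω', (∀ i ≤ k, X i ω = X i ω') → ω ∈ F → ω' ∈ F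

/-- The path stays in `A` during `[k, k + t]`. -/
def staysIn (X : ℕ → Ω → ℤ) (A : Set ℤ) (k t : ℕ) : Set Ω := {ω | ∀ i ≤ t, X (k + i) ω ∈ A}

/-- The level `n` is visited for the first time at time `k`. -/
def firstHit (X : ℕ → Ω → ℤ) (n k : ℕ) : Set Ω :=
  {ω | X k ω = n ∧ ∀ i < k, X i ω < n}

lemma departures_succ (x : ℕ → ℤ) (k : ℕ) :
    departures x (k + 1) = bump (departures x k) (x k) := by
  funext y
  by_cases h : y = x k
  · subst h
    rw [bump_self, departures, Finset.range_add_one, Finset.filter_insert, if_pos rfl,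
      Finset.card_insert_of_notMem (by simp)]
    rfl
  · rw [bump_of_ne _ h, departures, Finset.range_add_one, Finset.filter_insert,
      if_neg (Ne.symm h)]
    rfl

lemma departures_congr {x x' : ℕ → ℤ} {k : ℕ} (h : ∀ i < k, x i = x' i) :
    departures x k = departures x' k := by
  funext y
  unfold departures
  congr 1
  refine Finset.filter_congr fun i hi => ?_
  rw [h i (Finset.mem_range.1 hi)]

lemma followsPath_succ_update (X : ℕ → Ω → ℤ) (x : ℕ → ℤ) (k : ℕ) (z : ℤ) :
    followsPath X (Function.update x (k + 1) z) (k + 1) = {ω | X (k + 1) ω = z} ∩ followsPath X x k := by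
  ext ω
  constructor
  · intro h
    refine ⟨by simpa using h (k + 1) le_rfl, fun i hi => ?_⟩
    have := h i (by omega)
    rwa [Function.update_of_ne (by omega)] at this
  · rintro ⟨h₁, h₂⟩ i hi
    by_cases hik : i = k + 1
    · subst hik; simpa using h₁
    · rw [Function.update_of_ne hik]; exact h₂ i (by omega)

/-- The path up to time `k`. -/
def history (X : ℕ → Ω → ℤ) (k : ℕ) (ω : Ω) : Fin (k + 1) → ℤ := fun i => X i ω

lemma DeterminedBy.preimage_eq {X : ℕ → Ω → ℤ} {k : ℕ} {F : Set Ω} (hF : DeterminedBy X k F) :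
    history X k ⁻¹' (history X k '' F) = F := by
  refine (subset_preimage_image _ _).antisymm' ?_
  rintro ω ⟨ω', h', he⟩
  exact hF ω' ω (fun i hi => congrFun he ⟨i, by omega⟩) h'

lemma determinedBy_firstHit (X : ℕ → Ω → ℤ) (n k : ℕ) : DeterminedBy X k (firstHit X n k) :=
  fun ω ω' h hω => ⟨by rw [← h k le_rfl]; exact hω.1, fun i hi => by
    rw [← h i hi.le]; exact hω.2 i hi⟩

lemma DeterminedBy.inter {X : ℕ → Ω → ℤ} {k : ℕ} {F G : Set Ω} (hF : DeterminedBy X k F)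
    (hG : DeterminedBy X k G) : DeterminedBy X k (F ∩ G) :=
  fun ω ω' h hω => ⟨hF ω ω' h hω.1, hG ω ω' h hω.2⟩

lemma disjoint_firstHit (X : ℕ → Ω → ℤ) (n : ℕ) :
    Pairwise (Function.onFun Disjoint (firstHit X n)) := by
  intro i j hij
  rw [Function.onFun, Set.disjoint_left]
  intro ω h₁ h₂
  rcases lt_or_gt_of_ne hij with h | h
  · exact (h₂.2 i h).ne h₁.1
  · exact (h₁.2 j h).ne h₂.1

lemma sub_le_of_steps {x : ℕ → ℤ} (hx : ∀ n, x (n + 1) = x n + 1 ∨ x (n + 1) = x n - 1)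
    (k i : ℕ) : x (k + i) ≤ x k + i ∧ x k - i ≤ x (k + i) := by
  induction i with
  | zero => simp
  | succ i ih =>
    have := hx (k + i)
    rw [← add_assoc]
    push_cast
    omega

lemma exists_first_ge {x : ℕ → ℤ} (hx : ∀ n, x (n + 1) = x n + 1 ∨ x (n + 1) = x n - 1)
    (h0 : x 0 = 0) {n k : ℕ} (h : (n : ℤ) ≤ x k) : ∃ i, x i = n ∧ ∀ j < i, x j < n := by
  classical
  have hex : ∃ k, (n : ℤ) ≤ x k := ⟨k, h⟩
  refine ⟨Nat.find hex, ?_, fun j hj => not_le.1 (Nat.find_min hex hj)⟩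
  have hs := Nat.find_spec hex
  rcases hf : Nat.find hex with _ | i
  · rw [hf] at hs; omega
  · have := Nat.find_min hex (m := i) (by omega)
    have := hx i
    rw [hf] at hs
    omega

variable [MeasurableSpace Ω] {P : Measure Ω} {X : ℕ → Ω → ℤ} {M : ℕ} {p : ℕ → ℝ}

lemma IsCookieRW.measurableSet_eq (hX : IsCookieRW M p P X) (k : ℕ) (z : ℤ) :
    MeasurableSet {ω | X k ω = z} := hX.meas k (measurableSet_singleton z)

lemma IsCookieRW.measurableSet_followsPath (hX : IsCookieRW M p P X) (x : ℕ → ℤ) (k : ℕ) :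
    MeasurableSet (followsPath X x k) := by
  have : followsPath X x k = ⋂ i, ⋂ (_ : i ≤ k), {ω | X i ω = x i} := by ext; simp [followsPath]
  rw [this]
  exact MeasurableSet.iInter fun i => MeasurableSet.iInter fun _ => hX.measurableSet_eq i _

lemma IsCookieRW.measurableSet_staysIn (hX : IsCookieRW M p P X) (A : Set ℤ) (k t : ℕ) :
    MeasurableSet (staysIn X A k t) := by
  have : staysIn X A k t = ⋂ i, ⋂ (_ : i ≤ t), X (k + i) ⁻¹' A := by ext; simp [staysIn]
  rw [this]
  exact MeasurableSet.iInter fun i => MeasurableSet.iInter fun _ =>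
    hX.meas _ (MeasurableSet.of_discrete)

lemma IsCookieRW.ae_start (hX : IsCookieRW M p P X) : ∀ᵐ ω ∂P, X 0 ω = 0 := by
  have := hX.isProb
  exact (prob_compl_eq_zero_iff (hX.measurableSet_eq 0 0)).2 hX.init

lemma IsCookieRW.ae_steps (hX : IsCookieRW M p P X) :
    ∀ᵐ ω ∂P, ∀ n, X (n + 1) ω = X n ω + 1 ∨ X (n + 1) ω = X n ω - 1 := by
  have := hX.isProb
  rw [ae_all_iff]
  intro n
  have hm : MeasurableSet {ω | |X (n + 1) ω - X n ω| = 1} :=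
    ((hX.meas (n + 1)).sub (hX.meas n)) (MeasurableSet.of_discrete (s := {z : ℤ | |z| = 1}))
  have h := (prob_compl_eq_zero_iff hm).2 (hX.steps n)
  filter_upwards [show ∀ᵐ ω ∂P, |X (n + 1) ω - X n ω| = 1 from h] with ω hω
  rcases eq_or_eq_neg_of_abs_eq hω with h | h <;> omega

lemma IsCookieRW.real_right (hX : IsCookieRW M p P X) (hp : ∀ k, 0 ≤ cookieP M p (k + 1))
    (x : ℕ → ℤ) (k : ℕ) :
    P.real ({ω | X (k + 1) ω = x k + 1} ∩ followsPath X x k) =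
      cookieP M p (departures x k (x k) + 1) * P.real (followsPath X x k) := by
  have := hX.isProb
  rcases eq_or_ne (P (followsPath X x k)) 0 with h0 | h0
  · have h1 : P ({ω | X (k + 1) ω = x k + 1} ∩ followsPath X x k) = 0 :=
      measure_mono_null inter_subset_right h0
    simp [Measure.real, h0, h1]
  · have hx0 : x 0 = 0 := by
      by_contra hne
      refine h0 (measure_mono_null (t := {ω | X 0 ω = 0}ᶜ) (fun ω hω => ?_) hX.ae_start)
      have := hω 0 (Nat.zero_le k)
      simp only [mem_compl_iff, mem_ofPred_eq]
      omega
    have hc := hX.cond k x hx0 (pos_iff_ne_zero.2 h0)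
    have hcard : ((Finset.range (k + 1)).filter (fun i => x i = x k)).card =
        departures x k (x k) + 1 := by
      have := congrFun (departures_succ x k) (x k)
      rwa [bump_self] at this
    rw [hcard] at hc
    change P ({ω | X (k + 1) ω = x k + 1} ∩ followsPath X x k) = _ * P (followsPath X x k) at hc
    rw [Measure.real, hc, ENNReal.toReal_mul, ENNReal.toReal_ofReal (hp _), Measure.real]

lemma IsCookieRW.real_inter_split (hX : IsCookieRW M p P X) (x : ℕ → ℤ) (k : ℕ) {E : Set Ω}
    (hE : MeasurableSet E) :
    P.real (followsPath X x k ∩ E) =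
      P.real (followsPath X (Function.update x (k + 1) (x k + 1)) (k + 1) ∩ E) +
        P.real (followsPath X (Function.update x (k + 1) (x k - 1)) (k + 1) ∩ E) := by
  have := hX.isProb
  have hmeas := fun z => hX.measurableSet_followsPath (Function.update x (k + 1) z) (k + 1)
  rw [← measureReal_union _ ((hmeas _).inter hE)]
  · refine measureReal_congr ?_
    filter_upwards [hX.ae_steps] with ω hω
    refine propext ?_
    rw [followsPath_succ_update, followsPath_succ_update]
    constructor
    · rintro ⟨h₁, h₂⟩
      have hk := h₁ k le_rfl
      rcases hω k with h | h
      · exact Or.inl ⟨⟨by rw [mem_ofPred_eq, h, hk], h₁⟩, h₂⟩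
      · exact Or.inr ⟨⟨by rw [mem_ofPred_eq, h, hk], h₁⟩, h₂⟩
    · rintro (⟨⟨-, h₁⟩, h₂⟩ | ⟨⟨-, h₁⟩, h₂⟩) <;> exact ⟨h₁, h₂⟩
  · rw [Set.disjoint_left, followsPath_succ_update, followsPath_succ_update]
    rintro ω ⟨⟨h₁, -⟩, -⟩ ⟨⟨h₂, -⟩, -⟩
    rw [mem_ofPred_eq] at h₁ h₂
    omega

lemma IsCookieRW.real_followsPath_inter_staysIn (hX : IsCookieRW M p P X)
    (hp : ∀ k, 0 ≤ cookieP M p (k + 1)) (A : Set ℤ) (t : ℕ) (x : ℕ → ℤ) (k : ℕ) :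
    P.real (followsPath X x k ∩ staysIn X A k t) =
      surv (fun k => cookieP M p (k + 1)) freeLeft A t (departures x k) (x k) *
        P.real (followsPath X x k) := by
  induction t generalizing x k with
  | zero =>
    by_cases h : x k ∈ A
    · rw [surv_zero_of_mem h, one_mul, inter_eq_left.2]
      intro ω hω i hi
      obtain rfl : i = 0 := by omega
      rwa [add_zero, hω k le_rfl]
    · rw [surv_of_notMem h, zero_mul]
      have : followsPath X x k ∩ staysIn X A k 0 = ∅ := by
        rw [eq_empty_iff_forall_notMem]
        rintro ω ⟨h₁, h₂⟩
        have := h₂ 0 le_rfl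
        rw [add_zero, h₁ k le_rfl] at this
        exact h this
      rw [this, measureReal_empty]
  | succ t ih =>
    by_cases h : x k ∈ A
    · have hset : followsPath X x k ∩ staysIn X A k (t + 1) =
          followsPath X x k ∩ staysIn X A (k + 1) t := by
        ext ω
        refine and_congr_right fun h₁ => ⟨fun h₂ i hi => ?_, fun h₂ i hi => ?_⟩
        · have := h₂ (i + 1) (by omega)
          rwa [show k + (i + 1) = k + 1 + i by omega] at this
        · rcases i with _ | i
          · rwa [add_zero, h₁ k le_rfl]
          · have := h₂ i (by omega)
            rwa [show k + 1 + i = k + (i + 1) by omega] at this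
      have hdep : ∀ z, departures (Function.update x (k + 1) z) (k + 1) =
          bump (departures x k) (x k) := fun z => by
        rw [← departures_succ]
        exact departures_congr fun i hi => Function.update_of_ne (by omega) _ _
      have hr := hX.real_right hp x k
      rw [← followsPath_succ_update] at hr
      have hsplit := hX.real_inter_split x k MeasurableSet.univ
      simp only [inter_univ] at hsplit
      rw [hset, hX.real_inter_split x k (hX.measurableSet_staysIn _ _ _), ih, ih,
        surv_succ_of_mem h, stepOp, hdep, hdep, Function.update_self, Function.update_self]
      rw [hr] at hsplit ⊢
      have hl : P.real (followsPath X (Function.update x (k + 1) (x k - 1)) (k + 1)) =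
          (1 - cookieP M p (departures x k (x k) + 1)) * P.real (followsPath X x k) := by linarith
      rw [hl, freeLeft]
      ring
    · rw [surv_of_notMem h, zero_mul]
      have : followsPath X x k ∩ staysIn X A k (t + 1) = ∅ := by
        rw [eq_empty_iff_forall_notMem]
        rintro ω ⟨h₁, h₂⟩
        have := h₂ 0 (Nat.zero_le _)
        rw [add_zero, h₁ k le_rfl] at this
        exact h this
      rw [this, measureReal_empty]

lemma IsCookieRW.measurable_history (hX : IsCookieRW M p P X) (k : ℕ) :
    Measurable (history X k) :=
  measurable_pi_lambda _ fun i => hX.meas i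

lemma IsCookieRW.measurableSet_of_determinedBy (hX : IsCookieRW M p P X) {k : ℕ} {F : Set Ω}
    (hF : DeterminedBy X k F) : MeasurableSet F := by
  rw [← hF.preimage_eq]
  exact hX.measurable_history k MeasurableSet.of_discrete

/-- The Markov property of the walk with its departure counts. -/
lemma IsCookieRW.measure_inter_staysIn (hX : IsCookieRW M p P X)
    (hp : ∀ k, 0 ≤ cookieP M p (k + 1)) (A : Set ℤ) (t k : ℕ) {F : Set Ω}
    (hF : DeterminedBy X k F) {s : ℝ} (hs0 : 0 ≤ s)
    (hs : ∀ ω ∈ F, surv (fun k => cookieP M p (k + 1)) freeLeft A t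
      (departures (fun i => X i ω) k) (X k ω) = s) :
    P (F ∩ staysIn X A k t) = ENNReal.ofReal s * P F := by
  have := hX.isProb
  have hc : (history X k '' F).Countable := to_countable _
  have hm : ∀ h : Fin (k + 1) → ℤ, MeasurableSet (history X k ⁻¹' {h}) := fun h =>
    hX.measurable_history k MeasurableSet.of_discrete
  have hst := hX.measurableSet_staysIn A k t
  have e₁ := tsum_measure_preimage_singleton (μ := P) hc fun h _ => hm h
  have e₂ := tsum_measure_preimage_singleton (μ := P.restrict (staysIn X A k t)) hc
    fun h _ => hm h
  rw [hF.preimage_eq] at e₁ e₂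
  rw [Measure.restrict_apply' hst] at e₂
  rw [← e₁, ← e₂, ← ENNReal.tsum_mul_left]
  refine tsum_congr fun ⟨h, ω, hω, hh⟩ => ?_
  have hcyl : history X k ⁻¹' {h} = followsPath X (fun i => X i ω) k := by
    ext ω'
    rw [mem_preimage, mem_singleton_iff, ← hh]
    refine ⟨fun he i hi => congrFun he ⟨i, by omega⟩, fun he => funext fun i => he i ?_⟩
    omega
  have hmain := hX.real_followsPath_inter_staysIn hp A t (fun i => X i ω) k
  rw [hs ω hω] at hmain
  rw [Measure.restrict_apply' hst]
  change P (history X k ⁻¹' {h} ∩ _) = _ * P (history X k ⁻¹' {h})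
  rw [hcyl, ← ofReal_measureReal, hmain, ENNReal.ofReal_mul hs0, ofReal_measureReal]

lemma IsCookieRW.measure_staysIn_zero (hX : IsCookieRW M p P X)
    (hc : ∀ k, 1 / 2 ≤ cookieP M p (k + 1) ∧ cookieP M p (k + 1) < 1) (A : Set ℤ) (t : ℕ) :
    P (staysIn X A 0 t) =
      ENNReal.ofReal (surv (fun k => cookieP M p (k + 1)) freeLeft A t (fun _ => 0) 0) := by
  have hF : DeterminedBy X 0 {ω | X 0 ω = 0} := fun ω ω' h h' => by
    have := h 0 le_rfl
    simp only [mem_ofPred_eq] at h' ⊢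
    omega
  have h := hX.measure_inter_staysIn (fun k => by linarith [hc k]) A t 0 hF
    (surv_nonneg (c := fun k => cookieP M p (k + 1)) hc t (fun _ => 0) 0) (fun ω hω => by
      rw [show X 0 ω = 0 from hω]
      congr 1)
  rw [hX.init, mul_one] at h
  rw [← h]
  refine measure_congr ?_
  filter_upwards [hX.ae_start] with ω hω
  exact propext ⟨fun h => ⟨hω, h⟩, fun h => h.2⟩

lemma IsCookieRW.ae_firstHit (hX : IsCookieRW M p P X)
    (hc : ∀ k, 1 / 2 ≤ cookieP M p (k + 1) ∧ cookieP M p (k + 1) < 1) :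
    ∀ᵐ ω ∂P, ∀ n : ℕ, ∃ k, ω ∈ firstHit X n k := by
  rw [ae_all_iff]
  intro n
  have hnull : P {ω | ∀ t, X t ω < n} = 0 := by
    refine le_antisymm (ge_of_tendsto' (x := atTop) (f := fun t => P (staysIn X (Iio (n : ℤ)) 0 t))
      ?_ fun t => measure_mono fun ω hω i _ => hω _) zero_le
    simp only [hX.measure_staysIn_zero hc]
    rw [← ENNReal.ofReal_zero]
    exact ENNReal.tendsto_ofReal
      (tendsto_surv_freeLeft (c := fun k => cookieP M p (k + 1)) hc n fun _ => 0)
  have hae : ∀ᵐ ω ∂P, ¬ ∀ t, X t ω < n := by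
    rw [ae_iff]; simpa only [not_not] using hnull
  filter_upwards [hae, hX.ae_start, hX.ae_steps] with ω h₁ h₂ h₃
  push Not at h₁
  obtain ⟨t, ht⟩ := h₁
  exact exists_first_ge (x := fun k => X k ω) h₃ h₂ ht

/-- The probability that the walk started in a fresh environment stays nonnegative for `t` steps. -/
def freshSurv (M : ℕ) (p : ℕ → ℝ) (t : ℕ) : ℝ :=
  surv (fun k => cookieP M p (k + 1)) freeLeft (Ioi (-1)) t (fun _ => 0) 0

lemma IsCookieRW.measure_firstHit_inter_staysIn (hX : IsCookieRW M p P X)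
    (hc : ∀ k, 1 / 2 ≤ cookieP M p (k + 1) ∧ cookieP M p (k + 1) < 1) {n k : ℕ} {F : Set Ω}
    (hF : DeterminedBy X k F) (hFn : F ⊆ firstHit X n k) (t : ℕ) :
    P (F ∩ staysIn X (Ioi (-1 + n)) k t) = ENNReal.ofReal (freshSurv M p t) * P F := by
  refine hX.measure_inter_staysIn (fun k => by linarith [hc k]) _ t k hF
    (surv_nonneg (c := fun k => cookieP M p (k + 1)) hc t _ _) fun ω hω => ?_
  have hn := hFn hω
  have := surv_shift (c := fun k => cookieP M p (k + 1)) (-1) n t (departures (fun i => X i ω) k)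
    (fun _ => 0) 0 (fun y hy => by
      rw [departures, Finset.card_eq_zero, Finset.filter_eq_empty_iff]
      intro i hi
      have := hn.2 i (Finset.mem_range.1 hi)
      omega)
  rw [zero_add] at this
  rw [hn.1, this]
  rfl

lemma IsCookieRW.measure_firstHit_diff_staysIn (hX : IsCookieRW M p P X)
    (hc : ∀ k, 1 / 2 ≤ cookieP M p (k + 1) ∧ cookieP M p (k + 1) < 1) {n k : ℕ} {F : Set Ω}
    (hF : DeterminedBy X k F) (hFn : F ⊆ firstHit X n k) (t : ℕ) :
    P (F \ staysIn X (Ioi (-1 + n)) k t) = ENNReal.ofReal (1 - freshSurv M p t) * P F := by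
  have := hX.isProb
  have h := hX.measure_firstHit_inter_staysIn hc hF hFn t
  have h0 : 0 ≤ freshSurv M p t := surv_nonneg (c := fun k => cookieP M p (k + 1)) hc t _ _
  rw [← sdiff_inter_self_eq_sdiff, inter_comm, measure_sdiff inter_subset_left
    ((hX.measurableSet_of_determinedBy hF).inter
      (hX.measurableSet_staysIn _ _ _)).nullMeasurableSet (measure_ne_top _ _), h,
    ENNReal.ofReal_sub _ h0, ENNReal.sub_mul (fun _ _ => measure_ne_top _ _),
    ENNReal.ofReal_one, one_mul]

lemma IsCookieRW.measure_return_block_le (hX : IsCookieRW M p P X)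
    (hc : ∀ k, 1 / 2 ≤ cookieP M p (k + 1) ∧ cookieP M p (k + 1) < 1) (m t r : ℕ) :
    P {ω | ∀ i < r, ∃ k, ω ∈ firstHit X (m + i * (t + 1)) k ∧
      ω ∉ staysIn X (Ioi (-1 + (m + i * (t + 1) : ℕ))) k t} ≤
        ENNReal.ofReal (1 - freshSurv M p t) ^ r := by
  have := hX.isProb
  induction r with
  | zero => simp
  | succ r ih =>
    set a : ℕ → ℕ := fun i => m + i * (t + 1) with ha
    let G : ℕ → Set Ω := fun k => {ω | ∀ i < r, ∃ k', k' + t ≤ k ∧ ω ∈ firstHit X (a i) k' ∧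
      ω ∉ staysIn X (Ioi (-1 + (a i : ℕ))) k' t}
    have hG : ∀ k, DeterminedBy X k (G k) := by
      intro k ω ω' h hω i hi
      obtain ⟨k', hk', h₁, h₂⟩ := hω i hi
      refine ⟨k', hk', determinedBy_firstHit X _ k' ω ω' (fun i hi => h i (by omega)) h₁,
        fun h₃ => h₂ fun s hs => ?_⟩
      rw [h (k' + s) (by omega)]
      exact h₃ s hs
    have hGF : ∀ k, DeterminedBy X k (G k ∩ firstHit X (a r) k) := fun k =>
      (hG k).inter (determinedBy_firstHit X _ k)
    calc _ ≤ P (⋃ k, (G k ∩ firstHit X (a r) k) \ staysIn X (Ioi (-1 + (a r : ℕ))) k t) := by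
          refine measure_mono_ae ?_
          filter_upwards [hX.ae_steps] with ω hsteps hω
          obtain ⟨k, hk, hks⟩ := hω r (Nat.lt_succ_self r)
          refine mem_iUnion.2 ⟨k, ⟨fun i hi => ?_, hk⟩, hks⟩
          obtain ⟨k', hk', hks'⟩ := hω i (by omega)
          refine ⟨k', ?_, hk', hks'⟩
          have hai : a i + (t + 1) ≤ a r := by
            have : (i + 1) * (t + 1) ≤ r * (t + 1) := Nat.mul_le_mul_right _ hi
            simp only [ha]
            linarith
          have e₁ : X k ω = (a r : ℕ) := hk.1
          have e₂ : X k' ω = (a i : ℕ) := hk'.1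
          have hkk : k' ≤ k := by
            by_contra! hlt
            have : X k ω < (a i : ℕ) := hk'.2 k hlt
            omega
          obtain ⟨d, rfl⟩ := Nat.exists_eq_add_of_le hkk
          have := (sub_le_of_steps (x := fun k => X k ω) hsteps k' d).1
          omega
      _ ≤ ∑' k, P ((G k ∩ firstHit X (a r) k) \ staysIn X (Ioi (-1 + (a r : ℕ))) k t) :=
          measure_iUnion_le _
      _ = ENNReal.ofReal (1 - freshSurv M p t) * ∑' k, P (G k ∩ firstHit X (a r) k) := by
          rw [← ENNReal.tsum_mul_left]
          exact tsum_congr fun k =>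
            hX.measure_firstHit_diff_staysIn hc (hGF k) inter_subset_right t
      _ ≤ ENNReal.ofReal (1 - freshSurv M p t) * ENNReal.ofReal (1 - freshSurv M p t) ^ r := by
          gcongr
          rw [← measure_iUnion (fun i j hij => (disjoint_firstHit X (a r) hij).mono
            inter_subset_right inter_subset_right)
            fun k => hX.measurableSet_of_determinedBy (hGF k)]
          refine (measure_mono ?_).trans ih
          intro ω hω i hi
          obtain ⟨k, hk⟩ := mem_iUnion.1 hω
          obtain ⟨k', -, h⟩ := hk.1 i hi
          exact ⟨k', h⟩
      _ = _ := (pow_succ' _ _).symm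

lemma IsCookieRW.measure_late_return_le (hX : IsCookieRW M p P X)
    (hc : ∀ k, 1 / 2 ≤ cookieP M p (k + 1) ∧ cookieP M p (k + 1) < 1) {ε : ℝ}
    (hε : ∀ t, ε ≤ freshSurv M p t) (n t : ℕ) :
    P {ω | ∃ k, ω ∈ firstHit X n k ∧ ω ∈ staysIn X (Ioi (-1 + n)) k t ∧
      ∃ i, X (k + i) ω < n} ≤ ENNReal.ofReal (freshSurv M p t - ε) := by
  have := hX.isProb
  let S : ℕ → ℕ → Set Ω := fun k s => staysIn X (Ioi (-1 + n)) k s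
  have hSanti : ∀ k {s s'}, s ≤ s' → S k s' ⊆ S k s := fun k s s' h ω hω i hi =>
    hω i (hi.trans h)
  have h0 : ∀ s, 0 ≤ freshSurv M p s := fun s =>
    surv_nonneg (c := fun k => cookieP M p (k + 1)) hc s _ _
  have hbound : ∀ s, P (⋃ k, (firstHit X n k ∩ S k t) \ S k (t + s)) ≤
      ENNReal.ofReal (freshSurv M p t - ε) := by
    intro s
    calc _ ≤ ∑' k, P ((firstHit X n k ∩ S k t) \ S k (t + s)) := measure_iUnion_le _
      _ ≤ ∑' k, ENNReal.ofReal (freshSurv M p t - ε) * P (firstHit X n k) := by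
          refine ENNReal.tsum_le_tsum fun k => ?_
          have hdet := determinedBy_firstHit X n k
          have e₁ := hX.measure_firstHit_inter_staysIn hc hdet subset_rfl t
          have e₂ := hX.measure_firstHit_inter_staysIn hc hdet subset_rfl (t + s)
          have hset : (firstHit X n k ∩ S k t) \ S k (t + s) =
              (firstHit X n k ∩ S k t) \ (firstHit X n k ∩ S k (t + s)) := by
            ext ω
            simp only [Set.mem_sdiff, mem_inter_iff]
            tauto
          rw [hset, measure_sdiff (inter_subset_inter_right _ (hSanti k (Nat.le_add_right t s)))
            ((hX.measurableSet_of_determinedBy hdet).inter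
              (hX.measurableSet_staysIn _ _ _)).nullMeasurableSet (measure_ne_top _ _), e₁, e₂,
            ← ENNReal.sub_mul (fun _ _ => measure_ne_top _ _), ← ENNReal.ofReal_sub _ (h0 _)]
          gcongr
          exact hε _
      _ = ENNReal.ofReal (freshSurv M p t - ε) * P (⋃ k, firstHit X n k) := by
          rw [ENNReal.tsum_mul_left, measure_iUnion (disjoint_firstHit X n) fun k =>
            hX.measurableSet_of_determinedBy (determinedBy_firstHit X n k)]
      _ ≤ _ := mul_le_of_le_one_right' prob_le_one
  have hmono : Monotone fun s => ⋃ k, (firstHit X n k ∩ S k t) \ S k (t + s) := by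
    intro s s' h
    exact iUnion_mono fun k => sdiff_subset_sdiff_right (hSanti k (by omega))
  have hsup : P (⋃ s, ⋃ k, (firstHit X n k ∩ S k t) \ S k (t + s)) ≤
      ENNReal.ofReal (freshSurv M p t - ε) := by
    rw [hmono.measure_iUnion]
    exact iSup_le hbound
  refine (measure_mono ?_).trans hsup
  rintro ω ⟨k, h₁, h₂, i, h₃⟩
  refine mem_iUnion.2 ⟨i, mem_iUnion.2 ⟨k, ⟨h₁, h₂⟩, fun h => ?_⟩⟩
  have := h i (Nat.le_add_left i t)
  rw [mem_Ioi] at this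
  omega

/-- The walk never goes below level `n` after reaching it. -/
def noReturn (X : ℕ → Ω → ℤ) (n : ℕ) : Set Ω :=
  {ω | ∃ k, ω ∈ firstHit X n k ∧ ∀ i, k ≤ i → (n : ℤ) ≤ X i ω}

lemma IsCookieRW.exists_window (hX : IsCookieRW M p P X)
    (hc : ∀ k, 1 / 2 ≤ cookieP M p (k + 1) ∧ cookieP M p (k + 1) < 1) {ε : ℝ} (hε0 : 0 < ε)
    (hε : ∀ t, ε ≤ freshSurv M p t) (hlim : Tendsto (freshSurv M p) atTop (𝓝 ε))
    {η : ℝ} (hη : 0 < η) :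
    ∃ W : ℕ, ∀ m : ℕ, P {ω | ∀ w ≤ W, ω ∉ noReturn X (m + w)} ≤ ENNReal.ofReal η := by
  obtain ⟨r, hr⟩ := exists_pow_lt_of_lt_one (half_pos hη) (show 1 - ε < 1 by linarith)
  obtain ⟨t, ht⟩ : ∃ t, freshSurv M p t - ε < η / (2 * (r + 1)) := by
    have : 0 < η / (2 * ((r : ℝ) + 1)) := by positivity
    obtain ⟨t, ht⟩ := (hlim.eventually_lt_const (show ε < ε + η / (2 * (r + 1)) by linarith)).exists
    exact ⟨t, by linarith⟩
  have hle1 : freshSurv M p t ≤ 1 :=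
    surv_le_one (c := fun k => cookieP M p (k + 1)) hc t _ _
  refine ⟨r * (t + 1), fun m => ?_⟩
  set Q := {ω | ∀ i < r, ∃ k, ω ∈ firstHit X (m + i * (t + 1)) k ∧
      ω ∉ staysIn X (Ioi (-1 + (m + i * (t + 1) : ℕ))) k t}
  let C : ℕ → Set Ω := fun n => {ω | ∃ k, ω ∈ firstHit X n k ∧
    ω ∈ staysIn X (Ioi (-1 + n)) k t ∧ ∃ i, X (k + i) ω < n}
  calc _ ≤ P (Q ∪ ⋃ i ∈ Finset.range r, C (m + i * (t + 1))) := by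
        refine measure_mono_ae ?_
        filter_upwards [hX.ae_firstHit hc] with ω hhit hω
        by_contra hcon
        obtain ⟨hQ, hC⟩ := not_or.1 hcon
        refine hQ fun i hi => ?_
        obtain ⟨k, hk⟩ := hhit (m + i * (t + 1))
        refine ⟨k, hk, fun hs => hC ?_⟩
        refine mem_biUnion (Finset.mem_coe.2 (Finset.mem_range.2 hi)) ⟨k, hk, hs, ?_⟩
        by_contra! hall
        refine hω (i * (t + 1)) (Nat.mul_le_mul_right _ hi.le) ⟨k, hk, fun s hs => ?_⟩
        obtain ⟨d, rfl⟩ := Nat.exists_eq_add_of_le hs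
        exact hall d
    _ ≤ P Q + ∑ i ∈ Finset.range r, P (C (m + i * (t + 1))) :=
        (measure_union_le _ _).trans (by gcongr; exact measure_biUnion_finset_le _ _)
    _ ≤ ENNReal.ofReal (1 - freshSurv M p t) ^ r +
          ∑ i ∈ Finset.range r, ENNReal.ofReal (freshSurv M p t - ε) := by
        gcongr with i
        · exact hX.measure_return_block_le hc m t r
        · exact hX.measure_late_return_le hc hε _ t
    _ ≤ ENNReal.ofReal (η / 2) + ENNReal.ofReal (η / 2) := by
        gcongr
        · rw [← ENNReal.ofReal_pow (sub_nonneg.2 hle1)]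
          refine ENNReal.ofReal_le_ofReal (le_trans ?_ hr.le)
          exact pow_le_pow_left₀ (sub_nonneg.2 hle1) (by linarith [hε t]) r
        · rw [Finset.sum_const, Finset.card_range, ← ENNReal.ofReal_nsmul, nsmul_eq_mul]
          refine ENNReal.ofReal_le_ofReal ?_
          rw [lt_div_iff₀ (by positivity)] at ht
          nlinarith [hε t]
    _ = ENNReal.ofReal η := by
        rw [← ENNReal.ofReal_add (by positivity) (by positivity), add_halves]

lemma IsCookieRW.exists_uniform_backtrack_bound (hX : IsCookieRW M p P X)
    (hc : ∀ k, 1 / 2 ≤ cookieP M p (k + 1) ∧ cookieP M p (k + 1) < 1) {ε : ℝ} (hε0 : 0 < ε)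
    (hε : ∀ t, ε ≤ freshSurv M p t) (hlim : Tendsto (freshSurv M p) atTop (𝓝 ε))
    {η : ℝ} (hη : 0 < η) :
    ∃ K₀ : ℕ, ∀ K ≥ K₀, ∀ n : ℕ,
      P {ω | (K : ℤ) < (n : ℤ) - sInf ((fun i => X i ω) '' Set.Ici (hitT X n ω))} ≤
        ENNReal.ofReal η := by
  obtain ⟨W, hW⟩ := hX.exists_window hc hε0 hε hlim (half_pos hη)
  have hstay : Tendsto (fun t => P (staysIn X (Iio (W : ℤ)) 0 t)) atTop (𝓝 0) := by
    simp only [hX.measure_staysIn_zero hc]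
    rw [← ENNReal.ofReal_zero]
    exact ENNReal.tendsto_ofReal
      (tendsto_surv_freeLeft (c := fun k => cookieP M p (k + 1)) hc W fun _ => 0)
  obtain ⟨t₀, ht₀⟩ := eventually_atTop.1
    (hstay.eventually_le_const (ENNReal.ofReal_pos.2 (half_pos hη)))
  have hinf : ∀ {ω : Ω} {n K : ℕ} {b : ℤ}, n - b ≤ K → (∀ i ≥ hitT X n ω, b ≤ X i ω) →
      ¬ (K : ℤ) < (n : ℤ) - sInf ((fun i => X i ω) '' Set.Ici (hitT X n ω)) := by
    intro ω n K b hb h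
    have : b ≤ sInf ((fun i => X i ω) '' Set.Ici (hitT X n ω)) :=
      le_csInf (nonempty_Ici.image _) (by rintro _ ⟨i, hi, rfl⟩; exact h i hi)
    omega
  refine ⟨W + t₀, fun K hK n => ?_⟩
  rcases le_or_gt W n with hn | hn
  · refine le_trans (measure_mono_ae ?_) ((hW (n - W)).trans
      (ENNReal.ofReal_le_ofReal (half_le_self hη.le)))
    filter_upwards [hX.ae_firstHit hc] with ω hhit hω w hw hret
    obtain ⟨k, hk, hki⟩ := hret
    refine hinf (b := ((n - W + w : ℕ) : ℤ)) (by omega) (fun i hi => hki i (le_trans ?_ hi)) hω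
    by_contra! hlt
    have h₁ := hk.2 _ hlt
    obtain ⟨k', hk'⟩ := hhit n
    have h₂ : X (hitT X n ω) ω = n := Nat.sInf_mem (s := {k | X k ω = (n : ℤ)}) ⟨k', hk'.1⟩
    omega
  · calc _ ≤ P ({ω | ∀ w ≤ W, ω ∉ noReturn X (0 + w)} ∪ staysIn X (Iio (W : ℤ)) 0 (K - W)) := by
          refine measure_mono_ae ?_
          filter_upwards [hX.ae_start, hX.ae_steps] with ω h0 hsteps hω
          by_contra hcon
          obtain ⟨hret, hst⟩ := not_or.1 hcon
          simp only [mem_ofPred_eq, not_forall, not_not] at hret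
          obtain ⟨w, hw, k, hk, hki⟩ := hret
          simp only [staysIn, mem_ofPred_eq, not_forall, mem_Iio, not_lt, zero_add] at hst
          obtain ⟨i, hi, hiW⟩ := hst
          have hki' : k ≤ i := by
            by_contra! hlt
            have := hk.2 i hlt
            omega
          refine hinf (b := -((K - W : ℕ) : ℤ)) (by omega) (fun s _ => ?_) hω
          rcases le_or_gt k s with hs | hs
          · have := hki s hs
            omega
          · have := (sub_le_of_steps (x := fun k => X k ω) hsteps 0 s).2
            simp only [zero_add, h0] at this
            omega
      _ ≤ ENNReal.ofReal (η / 2) + ENNReal.ofReal (η / 2) :=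
          (measure_union_le _ _).trans (add_le_add (hW 0) (ht₀ _ (by omega)))
      _ = ENNReal.ofReal η := by
          rw [← ENNReal.ofReal_add (by positivity) (by positivity), add_halves]

end Walk

/-- For a transient cookie random walk, the overshoot to the left
of level `n` after time `T_n` is tight, uniformly in `n`: there is `f : ℕ → ℝ₊`
with `f(K) → 0` such that `P(n - inf_{i ≥ T_n} X_i > K) ≤ f(K)` for all `n, K`. -/
theorem backtrack_after_hitting_tight
    (M : ℕ) (hM : 1 ≤ M) (p : ℕ → ℝ)
    (hp : ∀ i, 1 ≤ i → i ≤ M → (1 / 2 : ℝ) ≤ p i ∧ p i < 1)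
    {Ω : Type*} [MeasurableSpace Ω] (P : Measure Ω) (X : ℕ → Ω → ℤ)
    (hX : IsCookieRW M p P X) (hα : 0 < cookieAlpha M p) :
    ∃ f : ℕ → ℝ, (∀ K, 0 ≤ f K) ∧ Tendsto f atTop (𝓝 0) ∧
      ∀ n K : ℕ,
        P {ω | (K : ℤ) < (n : ℤ) - sInf ((fun i => X i ω) '' Set.Ici (hitT X n ω))}
          ≤ ENNReal.ofReal (f K) := by
  have := hX.isProb
  have hc : ∀ k, 1 / 2 ≤ cookieP M p (k + 1) ∧ cookieP M p (k + 1) < 1 := by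
    intro k
    unfold cookieP
    split_ifs with h
    · exact hp (k + 1) (by omega) h
    · norm_num
  have hcM : ∀ k, M ≤ k → cookieP M p (k + 1) = 1 / 2 := fun k hk => by
    rw [cookieP, if_neg (by omega)]
  have hδ : 1 < driftFrom (fun k => cookieP M p (k + 1)) M 0 := by
    have hsum : driftFrom (fun k => cookieP M p (k + 1)) M 0 =
        ∑ i ∈ Finset.Icc 1 M, (2 * p i - 1) := by
      rw [driftFrom, ← Finset.Ico_succ_right_eq_Icc, Finset.sum_Ico_eq_sum_range,
        Finset.sum_Ico_eq_sum_range]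
      refine Finset.sum_congr (by simp) fun i hi => ?_
      have : i < M := by simpa using hi
      rw [cookieP, if_pos (by omega), zero_add, add_comm]
    rw [cookieAlpha] at hα
    linarith
  obtain ⟨ε, hε0, hlim, hε⟩ :=
    exists_surv_limit_pos (c := fun k => cookieP M p (k + 1)) hc hcM hδ
  set bad : ℕ → ℕ → Set Ω := fun n K =>
    {ω | (K : ℤ) < (n : ℤ) - sInf ((fun i => X i ω) '' Set.Ici (hitT X n ω))}
  have hbdd : ∀ K, BddAbove (range fun n => P.real (bad n K)) := fun K =>
    ⟨1, by rintro _ ⟨n, rfl⟩; exact measureReal_le_one⟩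
  have hnonneg : ∀ K, 0 ≤ ⨆ n, P.real (bad n K) := fun K =>
    Real.iSup_nonneg fun n => measureReal_nonneg
  refine ⟨fun K => ⨆ n, P.real (bad n K), hnonneg, ?_, fun n K => ?_⟩
  · rw [Metric.tendsto_atTop]
    intro η hη
    obtain ⟨K₀, hK₀⟩ := hX.exists_uniform_backtrack_bound hc hε0 hε hlim (half_pos hη)
    refine ⟨K₀, fun K hK => ?_⟩
    rw [Real.dist_eq, sub_zero, abs_of_nonneg (hnonneg K)]
    refine (ciSup_le fun n => ?_).trans_lt (half_lt_self hη)
    exact ENNReal.toReal_le_of_le_ofReal (half_pos hη).le (hK₀ K hK n)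
  · rw [← ofReal_measureReal (μ := P)]
    exact ENNReal.ofReal_le_ofReal (le_ciSup (hbdd K) n)
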